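/- For each of the two polynomials P_x(s) = 2s⁶ + 3s⁵ + 5s⁴ + 2s³ + 4s² + 3s + 1 and P_{y|z}(s) = 2s⁶ + 3s⁵ + 5s⁴ + 3s³ + 5s² + s + 1, let (d_k)_{k∈ℕ} be the Taylor coefficients at 0 of the rational function P_i(s)/((1 − s)³(s² + s + 1)²). Then in each case d_k/k² → 10/9 as k → ∞; in particular both sequences have quadratic growth and vanishing algebraic entropy lim_{k→∞} (1/k)·log d_k = 0. -/

import Mathlib

open Filter Polynomial

/-- A real sequence within linear distance of `c k²` satisfies `d k / k² → c`. -/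
theorem tendsto_div_sq_of_abs_sub_le {d : ℕ → ℝ} {c C : ℝ}
    (h : ∀ k : ℕ, |d k - c * (k : ℝ) ^ 2| ≤ C * (k + 1)) :
    Tendsto (fun k : ℕ => d k / (k : ℝ) ^ 2) atTop (nhds c) := by
  have inv := tendsto_inv_atTop_nhds_zero_nat (𝕜 := ℝ)
  have bound : Tendsto (fun k : ℕ => C * ((k : ℝ)⁻¹ + (k : ℝ)⁻¹ * (k : ℝ)⁻¹)) atTop (nhds 0) := by
    simpa using (inv.add (inv.mul inv)).const_mul C
  rw [tendsto_iff_dist_tendsto_zero]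
  refine squeeze_zero' (Eventually.of_forall fun _ => dist_nonneg) ?_ bound
  filter_upwards [eventually_gt_atTop 0] with k hk
  have hk' : (0 : ℝ) < k := by exact_mod_cast hk
  have e : d k / (k : ℝ) ^ 2 - c = (d k - c * (k : ℝ) ^ 2) / (k : ℝ) ^ 2 := by field_simp
  rw [Real.dist_eq, e, abs_div, abs_of_pos (pow_pos hk' 2), div_le_iff₀ (pow_pos hk' 2)]
  refine (h k).trans_eq ?_
  field_simp

/-- A sequence of exact quadratic growth has vanishing algebraic entropy. -/
theorem tendsto_log_div_of_tendsto_div_sq {d : ℕ → ℝ} {c : ℝ} (hc : c ≠ 0)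
    (h : Tendsto (fun k : ℕ => d k / (k : ℝ) ^ 2) atTop (nhds c)) :
    Tendsto (fun k : ℕ => Real.log (d k) / (k : ℝ)) atTop (nhds 0) := by
  have log_div : Tendsto (fun k : ℕ => Real.log k / (k : ℝ)) atTop (nhds 0) :=
    Real.isLittleO_log_id_atTop.tendsto_div_nhds_zero.comp tendsto_natCast_atTop_atTop
  have lim := ((h.log hc).mul (tendsto_inv_atTop_nhds_zero_nat (𝕜 := ℝ))).add
    (log_div.const_mul 2)
  simp only [mul_zero, add_zero] at lim
  refine lim.congr' ?_
  filter_upwards [eventually_gt_atTop 0, h.eventually_ne hc] with k hk hne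
  have hk' : (k : ℝ) ≠ 0 := by exact_mod_cast hk.ne'
  have hd : d k ≠ 0 := by
    rintro h0
    simp [h0] at hne
  rw [Real.log_div hd (pow_ne_zero 2 hk'), Real.log_pow]
  push_cast
  field_simp
  ring

/-- Coefficients of a power series multiplied by `(1 - X)³ (X² + X + 1)²`. -/
theorem coeff_eq_of_denominator_mul_eq {d : ℕ → ℝ} {P : Polynomial ℝ}
    (h : (((1 - X) ^ 3 * (X ^ 2 + X + 1) ^ 2 : Polynomial ℝ) : PowerSeries ℝ) *
      PowerSeries.mk d = (P : PowerSeries ℝ)) (n : ℕ) :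
    d n - (if 1 ≤ n then d (n - 1) else 0) - 2 * (if 3 ≤ n then d (n - 3) else 0)
      + 2 * (if 4 ≤ n then d (n - 4) else 0) + (if 6 ≤ n then d (n - 6) else 0)
      - (if 7 ≤ n then d (n - 7) else 0) = P.coeff n := by
  have expand : (((1 - X) ^ 3 * (X ^ 2 + X + 1) ^ 2 : Polynomial ℝ) : PowerSeries ℝ) *
      PowerSeries.mk d = PowerSeries.mk d - PowerSeries.X ^ 1 * PowerSeries.mk d
        - (2 : ℝ) • (PowerSeries.X ^ 3 * PowerSeries.mk d)
        + (2 : ℝ) • (PowerSeries.X ^ 4 * PowerSeries.mk d)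
        + PowerSeries.X ^ 6 * PowerSeries.mk d - PowerSeries.X ^ 7 * PowerSeries.mk d := by
    push_cast
    simp only [two_smul]
    ring
  have hn := congrArg (PowerSeries.coeff n) (expand.symm.trans h)
  simpa only [map_add, map_sub, PowerSeries.coeff_smul, PowerSeries.coeff_X_pow_mul',
    PowerSeries.coeff_mk, Polynomial.coeff_coe, smul_eq_mul] using hn

/-- The recurrence with characteristic polynomial `(1 - X)³ (X² + X + 1)²` is solved by a
quadratic on each residue class modulo 3, the leading coefficients being equal. -/
theorem eq_quadratic_of_recurrence {d : ℕ → ℝ} {a : ℝ} {b c : Fin 3 → ℝ}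
    (hrec : ∀ n : ℕ,
      d (n + 7) - d (n + 6) - 2 * d (n + 4) + 2 * d (n + 3) + d (n + 1) - d n = 0)
    (h0 : d 0 = c 0) (h1 : d 1 = c 1) (h2 : d 2 = c 2)
    (h3 : d 3 = a + b 0 + c 0) (h4 : d 4 = a + b 1 + c 1) (h5 : d 5 = a + b 2 + c 2)
    (h6 : d 6 = 4 * a + 2 * b 0 + c 0) (m : ℕ) (r : Fin 3) :
    d (3 * m + r) = a * (m : ℝ) ^ 2 + b r * m + c r := by
  have main : ∀ m : ℕ,
      d (3 * m) = a * (m : ℝ) ^ 2 + b 0 * m + c 0 ∧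
      d (3 * m + 1) = a * (m : ℝ) ^ 2 + b 1 * m + c 1 ∧
      d (3 * m + 2) = a * (m : ℝ) ^ 2 + b 2 * m + c 2 ∧
      d (3 * m + 3) = a * ((m : ℝ) + 1) ^ 2 + b 0 * (m + 1) + c 0 ∧
      d (3 * m + 4) = a * ((m : ℝ) + 1) ^ 2 + b 1 * (m + 1) + c 1 ∧
      d (3 * m + 5) = a * ((m : ℝ) + 1) ^ 2 + b 2 * (m + 1) + c 2 ∧
      d (3 * m + 6) = a * ((m : ℝ) + 2) ^ 2 + b 0 * (m + 2) + c 0 := by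
    intro m
    induction m with
    | zero =>
      norm_num
      refine ⟨h0, h1, h2, h3, h4, h5, ?_⟩
      linarith
    | succ m ih =>
      obtain ⟨e0, e1, e2, e3, e4, e5, e6⟩ := ih
      have r7 := hrec (3 * m)
      have r8 := hrec (3 * m + 1)
      have r9 := hrec (3 * m + 2)
      simp only [add_assoc, Nat.reduceAdd] at r7 r8 r9
      simp only [mul_add, add_assoc, Nat.reduceAdd, Nat.reduceMul]
      push_cast
      refine ⟨?_, ?_, ?_, ?_, ?_, ?_, ?_⟩ <;> linarith
  obtain ⟨e0, e1, e2, -⟩ := main m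
  fin_cases r
  exacts [e0, e1, e2]

/-- Quadratics on the residue classes modulo 3 with leading coefficient `10` interpolate
`10/9 k²` up to a linear error. -/
theorem abs_sub_le_of_eq_quadratic {d : ℕ → ℝ} {b c : Fin 3 → ℝ}
    (hb : ∀ r, b r ∈ Set.Icc 0 20) (hc : ∀ r, c r ∈ Set.Icc 0 20)
    (h : ∀ (m : ℕ) (r : Fin 3), d (3 * m + r) = 10 * (m : ℝ) ^ 2 + b r * m + c r) (k : ℕ) :
    |d k - 10 / 9 * (k : ℝ) ^ 2| ≤ 20 * ((k : ℝ) + 1) := by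
  obtain ⟨m, r, rfl⟩ : ∃ (m : ℕ) (r : Fin 3), k = 3 * m + r :=
    ⟨k / 3, ⟨k % 3, Nat.mod_lt _ (by norm_num)⟩, (Nat.div_add_mod k 3).symm⟩
  obtain ⟨b0, b1⟩ := hb r
  obtain ⟨c0, c1⟩ := hc r
  have hm : (0 : ℝ) ≤ m := m.cast_nonneg
  have lower := mul_nonneg b0 hm
  have upper := mul_le_mul_of_nonneg_right b1 hm
  rw [h, abs_le]
  fin_cases r <;> push_cast <;> simp only [Fin.isValue, Fin.zero_eta, Fin.mk_one,
    Fin.reduceFinMk] at * <;> constructor <;> linarith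

/-- Growth of a sequence given by the recurrence and seven initial values. -/
theorem quadratic_growth_of_recurrence {d : ℕ → ℝ} {b c : Fin 3 → ℝ}
    (hb : ∀ r, b r ∈ Set.Icc 0 20) (hc : ∀ r, c r ∈ Set.Icc 0 20)
    (hrec : ∀ n : ℕ,
      d (n + 7) - d (n + 6) - 2 * d (n + 4) + 2 * d (n + 3) + d (n + 1) - d n = 0)
    (h0 : d 0 = c 0) (h1 : d 1 = c 1) (h2 : d 2 = c 2)
    (h3 : d 3 = 10 + b 0 + c 0) (h4 : d 4 = 10 + b 1 + c 1) (h5 : d 5 = 10 + b 2 + c 2)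
    (h6 : d 6 = 4 * 10 + 2 * b 0 + c 0) :
    Tendsto (fun k : ℕ => d k / (k : ℝ) ^ 2) atTop (nhds (10 / 9)) ∧
      Tendsto (fun k : ℕ => Real.log (d k) / (k : ℝ)) atTop (nhds 0) := by
  have lim := tendsto_div_sq_of_abs_sub_le <| abs_sub_le_of_eq_quadratic hb hc <|
    eq_quadratic_of_recurrence hrec h0 h1 h2 h3 h4 h5 h6
  exact ⟨lim, tendsto_log_div_of_tendsto_div_sq (by norm_num) lim⟩



/-- The Taylor coefficients of `P_i(s)/((1-s)³(s²+s+1)²)` for the two numerators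
`P_x, P_{y|z}` of the Schwarzian Boussinesq system both satisfy `d_k/k² → 10/9`:
quadratic growth and vanishing algebraic entropy `lim (1/k) log d_k = 0`. -/
theorem SchwarzianBoussinesq_quadratic_growth
    (dx dyz : ℕ → ℝ)
    (hx : (((1 - X) ^ 3 * (X ^ 2 + X + 1) ^ 2 : Polynomial ℝ) : PowerSeries ℝ) *
        PowerSeries.mk dx =
      ((2 * X ^ 6 + 3 * X ^ 5 + 5 * X ^ 4 + 2 * X ^ 3 + 4 * X ^ 2 + 3 * X + 1 :
        Polynomial ℝ) : PowerSeries ℝ))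
    (hyz : (((1 - X) ^ 3 * (X ^ 2 + X + 1) ^ 2 : Polynomial ℝ) : PowerSeries ℝ) *
        PowerSeries.mk dyz =
      ((2 * X ^ 6 + 3 * X ^ 5 + 5 * X ^ 4 + 3 * X ^ 3 + 5 * X ^ 2 + X + 1 :
        Polynomial ℝ) : PowerSeries ℝ)) :
    (Tendsto (fun k : ℕ => dx k / (k : ℝ) ^ 2) atTop (nhds (10 / 9)) ∧
      Tendsto (fun k : ℕ => Real.log (dx k) / (k : ℝ)) atTop (nhds 0)) ∧
    (Tendsto (fun k : ℕ => dyz k / (k : ℝ) ^ 2) atTop (nhds (10 / 9)) ∧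
      Tendsto (fun k : ℕ => Real.log (dyz k) / (k : ℝ)) atTop (nhds 0)) := by
  constructor
  · have coeffs := coeff_eq_of_denominator_mul_eq hx
    have e0 := coeffs 0
    have e1 := coeffs 1
    have e2 := coeffs 2
    have e3 := coeffs 3
    have e4 := coeffs 4
    have e5 := coeffs 5
    have e6 := coeffs 6
    have hrec := fun n => coeffs (n + 7)
    simp [coeff_X, coeff_one, coeff_X_pow, coeff_ofNat_mul] at e0 e1 e2 e3 e4 e5 e6 hrec
    refine quadratic_growth_of_recurrence (b := ![1, 9, 16]) (c := ![1, 4, 8]) ?_ ?_ hrec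
      ?_ ?_ ?_ ?_ ?_ ?_ ?_
    · intro r; fin_cases r <;> norm_num
    · intro r; fin_cases r <;> norm_num
    all_goals
      simp
      linarith
  · have coeffs := coeff_eq_of_denominator_mul_eq hyz
    have e0 := coeffs 0
    have e1 := coeffs 1
    have e2 := coeffs 2
    have e3 := coeffs 3
    have e4 := coeffs 4
    have e5 := coeffs 5
    have e6 := coeffs 6
    have hrec := fun n => coeffs (n + 7)
    simp [coeff_X, coeff_one, coeff_X_pow, coeff_ofNat_mul] at e0 e1 e2 e3 e4 e5 e6 hrec
    refine quadratic_growth_of_recurrence (b := ![1, 7, 15]) (c := ![1, 2, 7]) ?_ ?_ hrec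
      ?_ ?_ ?_ ?_ ?_ ?_ ?_
    · intro r; fin_cases r <;> norm_num
    · intro r; fin_cases r <;> norm_num
    all_goals
      simp
      linarith
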